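/- arXiv:2504.17103 — 4 statements merged into one kernel-verified Lean document; each statement's English description precedes it below -/
import Mathlib

section
/- Let F = (G, p) and F' = (G', p') be d-dimensional frameworks with |V| ≥ 2 and |V'| ≥ 2, whose realizations agree on V ∩ V' and whose combined realization on V ∪ V' is injective. Suppose V ∩ V' = {a} is a single vertex. Then the union framework F ∪ F' is not infinitesimally bearing rigid: the vector u defined by u_i = 0 for i ∈ V and u_i = p_i − p_a for i ∈ V' is an infinitesimal motion of F ∪ F' that does not lie in T(p). -/
open scoped RealInnerProductSpace

noncomputable section

/-- `P_{xy} v`: the orthogonal projection matrix `P = I - b bᵀ` (with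
`b = (y - x)/‖y - x‖` the bearing from `x` to `y`) applied to the vector `v`. -/
def bproj {d : ℕ} (x y v : EuclideanSpace ℝ (Fin d)) : EuclideanSpace ℝ (Fin d) :=
  v - ⟪‖y - x‖⁻¹ • (y - x), v⟫ • (‖y - x‖⁻¹ • (y - x))

/-- `u` is an infinitesimal motion of the framework `(G, p)`:
`P_ij (u_i − u_j) = 0` for every edge `{i, j}`. -/
def IsInfMotion {d : ℕ} {V : Type*} (G : SimpleGraph V)
    (p u : V → EuclideanSpace ℝ (Fin d)) : Prop :=
  ∀ i j, G.Adj i j → bproj (p i) (p j) (u i - u j) = 0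

/-- A framework with vertex set `S` (a subset of the ambient vertex type), edge set given
by the graph `G` (whose edges all join vertices of `S`), and realization `p`, is
infinitesimally bearing rigid (IBR) if it has at least two vertices and every
infinitesimal motion coincides on `S` with an infinitesimal trivial motion. -/
def IsIBROn {d : ℕ} {V : Type*} (S : Set V) (G : SimpleGraph V)
    (p : V → EuclideanSpace ℝ (Fin d)) : Prop :=
  2 ≤ S.ncard ∧
    ∀ u : V → EuclideanSpace ℝ (Fin d), IsInfMotion G p u →
      ∃ (α : ℝ) (v : EuclideanSpace ℝ (Fin d)), ∀ i ∈ S, u i = α • p i + v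

theorem bproj_zero_right {d : ℕ} (x y : EuclideanSpace ℝ (Fin d)) : bproj x y 0 = 0 := by
  simp [bproj]

theorem bproj_sub {d : ℕ} (x y : EuclideanSpace ℝ (Fin d)) : bproj x y (x - y) = 0 := by
  unfold bproj
  by_cases h : y = x
  · simp [h]
  have hr : ‖y - x‖ ≠ 0 := norm_ne_zero_iff.mpr (sub_ne_zero.mpr h)
  have hxy : x - y = -(y - x) := (neg_sub y x).symm
  rw [hxy, inner_neg_right, real_inner_smul_left, real_inner_self_eq_norm_sq, smul_smul]
  have : -(‖y - x‖⁻¹ * ‖y - x‖ ^ 2) * ‖y - x‖⁻¹ = -1 := by field_simp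
  rw [this]
  simp

/-- If two frameworks `F = (G, p|_S)` and `F' = (G', p|_{S'})` (each with
at least two vertices, with a common realization `p` injective on `S ∪ S'`) share exactly
one vertex `a`, then their union is not infinitesimally bearing rigid: the vector `u`
which is `0` on `S` and `p_i − p_a` on `S'` is an infinitesimal motion of the union that
does not lie in `T(p)`. -/
theorem union_single_common_vertex_not_IBR
    {d : ℕ} {V : Type*} [Fintype V] (S S' : Set V) [DecidablePred (· ∈ S)]
    (G G' : SimpleGraph V)
    (hG : ∀ i j, G.Adj i j → i ∈ S ∧ j ∈ S)
    (hG' : ∀ i j, G'.Adj i j → i ∈ S' ∧ j ∈ S')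
    (p : V → EuclideanSpace ℝ (Fin d)) (hp : Set.InjOn p (S ∪ S'))
    (hS : 2 ≤ S.ncard) (hS' : 2 ≤ S'.ncard)
    (a : V) (ha : S ∩ S' = {a}) :
    IsInfMotion (G ⊔ G') p (fun i => if i ∈ S then 0 else p i - p a) ∧
    (¬ ∃ (α : ℝ) (v : EuclideanSpace ℝ (Fin d)),
        ∀ i ∈ S ∪ S', (if i ∈ S then 0 else p i - p a) = α • p i + v) ∧
    ¬ IsIBROn (S ∪ S') (G ⊔ G') p := by
  have haS : a ∈ S ∧ a ∈ S' := by
    have : a ∈ S ∩ S' := by rw [ha]; rfl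
    exact this
  have hu : ∀ i ∈ S', (if i ∈ S then 0 else p i - p a) = p i - p a := by
    intro i hi
    split_ifs with h
    · have : i ∈ S ∩ S' := ⟨h, hi⟩
      rw [ha] at this
      rw [Set.mem_singleton_iff.mp this, sub_self]
    · rfl
  have h1 : IsInfMotion (G ⊔ G') p (fun i => if i ∈ S then 0 else p i - p a) := by
    intro i j hij
    rcases hij with h | h
    · obtain ⟨hi, hj⟩ := hG i j h
      simp only [hi, hj, if_true, sub_self]
      exact bproj_zero_right _ _
    · obtain ⟨hi, hj⟩ := hG' i j h
      simp only [hu i hi, hu j hj, sub_sub_sub_cancel_right]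
      exact bproj_sub _ _
  have h2 : ¬ ∃ (α : ℝ) (v : EuclideanSpace ℝ (Fin d)),
      ∀ i ∈ S ∪ S', (if i ∈ S then 0 else p i - p a) = α • p i + v := by
    rintro ⟨α, v, h⟩
    obtain ⟨b, hb, hba⟩ := Set.exists_ne_of_one_lt_ncard (s := S) (by omega) a
    obtain ⟨c, hc, hca⟩ := Set.exists_ne_of_one_lt_ncard (s := S') (by omega) a
    have ea := h a (Or.inl haS.1)
    have eb := h b (Or.inl hb)
    have ec := h c (Or.inr hc)
    rw [if_pos haS.1] at ea
    rw [if_pos hb] at eb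
    rw [hu c hc] at ec
    have hpb : p b - p a ≠ 0 := fun e =>
      hba (hp (Or.inl hb) (Or.inl haS.1) (sub_eq_zero.mp e))
    have hpc : p c - p a ≠ 0 := fun e =>
      hca (hp (Or.inr hc) (Or.inl haS.1) (sub_eq_zero.mp e))
    have e1 : α • (p b - p a) = 0 := by
      rw [smul_sub, ← add_sub_add_right_eq_sub _ _ v, ← ea, ← eb, sub_self]
    have hα : α = 0 := (smul_eq_zero.mp e1).resolve_right hpb
    subst hα
    rw [zero_smul, zero_add] at ea ec
    exact hpc (ec.trans ea.symm)
  exact ⟨h1, h2, fun h => h2 (h.2 _ h1)⟩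

end
end

section
/- Let F = (G, p) and F' = (G', p') be d-dimensional infinitesimally bearing rigid frameworks with |V| ≥ 2 and |V'| ≥ 2, whose realizations agree on V ∩ V' and whose combined realization on V ∪ V' is injective. If |V ∩ V'| ≥ 2, then the union framework F ∪ F' is infinitesimally bearing rigid. -/
open scoped RealInnerProductSpace

noncomputable section

/-- If two infinitesimally bearing rigid frameworks `F = (G, p|_S)` and
`F' = (G', p|_{S'})` (each with at least two vertices, common realization `p` injective on
`S ∪ S'`) share at least two vertices, then their union framework is infinitesimally
bearing rigid. -/
theorem union_IBR_of_two_common_vertices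
    {d : ℕ} {V : Type*} [Fintype V] (S S' : Set V)
    (G G' : SimpleGraph V)
    (hG : ∀ i j, G.Adj i j → i ∈ S ∧ j ∈ S)
    (hG' : ∀ i j, G'.Adj i j → i ∈ S' ∧ j ∈ S')
    (p : V → EuclideanSpace ℝ (Fin d)) (hp : Set.InjOn p (S ∪ S'))
    (hF : IsIBROn S G p) (hF' : IsIBROn S' G' p)
    (hinter : 2 ≤ (S ∩ S').ncard) :
    IsIBROn (S ∪ S') (G ⊔ G') p := by
  refine ⟨hF.1.trans (Set.ncard_le_ncard Set.subset_union_left (Set.toFinite _)), ?_⟩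
  intro u hu
  obtain ⟨α, v, h1⟩ := hF.2 u (fun i j h => hu i j (Or.inl h))
  obtain ⟨β, w, h2⟩ := hF'.2 u (fun i j h => hu i j (Or.inr h))
  obtain ⟨a, ha, b, hb, hab⟩ := (Set.one_lt_ncard (Set.toFinite _)).1 hinter
  have ea : α • p a + v = β • p a + w := (h1 a ha.1).symm.trans (h2 a ha.2)
  have eb : α • p b + v = β • p b + w := (h1 b hb.1).symm.trans (h2 b hb.2)
  have hne : p a - p b ≠ 0 := fun h =>
    hab (hp (Or.inl ha.1) (Or.inl hb.1) (sub_eq_zero.1 h))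
  have h0 : (α - β) • (p a - p b) = 0 := by
    have e : (α - β) • (p a - p b)
        = (α • p a + v - (β • p a + w)) - (α • p b + v - (β • p b + w)) := by
      module
    rw [e, ea, eb]
    simp
  have hαβ : α = β := sub_eq_zero.1 ((smul_eq_zero.1 h0).resolve_right hne)
  subst hαβ
  have hvw : v = w := add_left_cancel ea
  subst hvw
  refine ⟨α, v, ?_⟩
  rintro i (hi | hi)
  · exact h1 i hi
  · exact h2 i hi

end
end

section
/- Let F = (G, p) and F' = (G', p') be d-dimensional infinitesimally bearing rigid frameworks with |V| ≥ 2 and |V'| ≥ 2, whose realizations agree on V ∩ V' and whose combined realization on V ∪ V' is injective. Then the union framework F ∪ F' is infinitesimally bearing rigid if and only if |V ∩ V'| ≥ 2. -/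
open scoped RealInnerProductSpace

noncomputable section

/-- Let `F = (G, p|_S)` and `F' = (G', p|_{S'})` be infinitesimally
bearing rigid frameworks (each with at least two vertices, common realization `p`
injective on `S ∪ S'`). Then their union framework is infinitesimally bearing rigid if
and only if they share at least two vertices. -/
theorem union_IBR_iff_two_common_vertices
    {d : ℕ} {V : Type*} [Fintype V] (S S' : Set V)
    (G G' : SimpleGraph V)
    (hG : ∀ i j, G.Adj i j → i ∈ S ∧ j ∈ S)
    (hG' : ∀ i j, G'.Adj i j → i ∈ S' ∧ j ∈ S')
    (p : V → EuclideanSpace ℝ (Fin d)) (hp : Set.InjOn p (S ∪ S'))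
    (hF : IsIBROn S G p) (hF' : IsIBROn S' G' p) :
    IsIBROn (S ∪ S') (G ⊔ G') p ↔ 2 ≤ (S ∩ S').ncard := by
  have htriv : ∀ x y : EuclideanSpace ℝ (Fin d), bproj x y (x - y) = 0 := by
    intro x y
    unfold bproj
    by_cases h : y - x = 0
    · have : x - y = 0 := by rw [← neg_sub, h, neg_zero]
      simp [this]
    · have hn : ‖y - x‖ ≠ 0 := norm_ne_zero_iff.mpr h
      have e : x - y = -(y - x) := (neg_sub y x).symm
      rw [e, inner_neg_right, real_inner_smul_left, real_inner_self_eq_norm_sq, smul_smul]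
      have : -(‖y - x‖⁻¹ * ‖y - x‖ ^ 2) * ‖y - x‖⁻¹ = -1 := by field_simp
      rw [this]; simp
  have hzero : ∀ x y : EuclideanSpace ℝ (Fin d), bproj x y 0 = 0 := by
    intro x y; simp [bproj]
  obtain ⟨hS, hF⟩ := hF
  obtain ⟨hS', hF'⟩ := hF'
  have key : ∀ (a b : V), a ∈ S ∪ S' → b ∈ S ∪ S' → a ≠ b →
      ∀ (α β : ℝ) (v w : EuclideanSpace ℝ (Fin d)),
      α • p a + v = β • p a + w → α • p b + v = β • p b + w → α = β ∧ v = w := by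
    intro a b ha hb hab α β v w h1 h2
    have hpab : p a - p b ≠ 0 := sub_ne_zero.mpr fun h => hab (hp ha hb h)
    have h3 : (α - β) • (p a - p b) = 0 := by
      have : (α - β) • (p a - p b) =
        (α • p a + v - (β • p a + w)) - (α • p b + v - (β • p b + w)) := by module
      rw [this, h1, h2]; simp
    have h4 : α = β := by
      rcases smul_eq_zero.mp h3 with h | h
      · exact sub_eq_zero.mp h
      · exact absurd h hpab
    subst h4
    exact ⟨rfl, add_left_cancel h1⟩
  constructor
  · rintro ⟨-, hU⟩
    by_contra hlt
    have hle : (S ∩ S').ncard ≤ 1 := by omega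
    have hc : ∃ c : EuclideanSpace ℝ (Fin d), ∀ i ∈ S ∩ S', p i = c := by
      rcases (S ∩ S').eq_empty_or_nonempty with h | ⟨c, hc⟩
      · exact ⟨0, fun i hi => by simp [h] at hi⟩
      · exact ⟨p c, fun i hi => by rw [(Set.ncard_le_one (Set.toFinite _)).mp hle i hi c hc]⟩
    obtain ⟨c, hc⟩ := hc
    classical
    let u : V → EuclideanSpace ℝ (Fin d) := fun i => if i ∈ S then p i - c else 0
    have huS : ∀ i ∈ S, u i = p i - c := fun i hi => if_pos hi
    have huS' : ∀ i ∈ S', u i = 0 := by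
      intro i hi
      by_cases h : i ∈ S
      · rw [huS i h, hc i ⟨h, hi⟩, sub_self]
      · exact if_neg h
    obtain ⟨α, v, h⟩ := hU u (by
      intro i j hij
      rcases hij with hij | hij
      · obtain ⟨hi, hj⟩ := hG i j hij
        rw [huS i hi, huS j hj, sub_sub_sub_cancel_right]
        exact htriv _ _
      · obtain ⟨hi, hj⟩ := hG' i j hij
        rw [huS' i hi, huS' j hj, sub_self]
        exact hzero _ _)
    obtain ⟨a, ha, b, hb, hab⟩ := (Set.one_lt_ncard (Set.toFinite _)).mp hS'
    obtain ⟨a', ha', b', hb', hab'⟩ := (Set.one_lt_ncard (Set.toFinite _)).mp hS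
    obtain ⟨h0, h0'⟩ := key a b (Or.inr ha) (Or.inr hb) hab α 0 v 0
      (by rw [← h a (Or.inr ha), huS' a ha]; simp)
      (by rw [← h b (Or.inr hb), huS' b hb]; simp)
    subst h0 h0'
    have e1 := h a' (Or.inl ha')
    have e2 := h b' (Or.inl hb')
    rw [huS a' ha', zero_smul, add_zero, sub_eq_zero] at e1
    rw [huS b' hb', zero_smul, add_zero, sub_eq_zero] at e2
    exact hab' (hp (Or.inl ha') (Or.inl hb') (e1.trans e2.symm))
  · intro h2
    refine ⟨hS.trans (Set.ncard_le_ncard Set.subset_union_left (Set.toFinite _)), ?_⟩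
    intro u hu
    obtain ⟨α, v, h⟩ := hF u fun i j hij => hu i j (Or.inl hij)
    obtain ⟨β, w, h'⟩ := hF' u fun i j hij => hu i j (Or.inr hij)
    obtain ⟨a, ha, b, hb, hab⟩ := (Set.one_lt_ncard (Set.toFinite _)).mp h2
    obtain ⟨e, e'⟩ := key a b (Or.inl ha.1) (Or.inl hb.1) hab α β v w
      ((h a ha.1).symm.trans (h' a ha.2)) ((h b hb.1).symm.trans (h' b hb.2))
    subst e e'
    exact ⟨α, v, fun i hi => hi.elim (h i) (h' i)⟩

end
end

section
/- Let (G, p) be a d-dimensional framework with |V| = n ≥ 2, let w_ij = w_ji > 0 be positive weights on the edges, and let B be the weighted bearing Laplacian. Then (G, p) is infinitesimally bearing rigid if and only if the kernel of B has dimension at most d + 1 (equivalently, exactly d + 1; equivalently, the (d+2)-th smallest eigenvalue of the positive semi-definite operator B, counted with multiplicity, is strictly positive). -/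
open scoped RealInnerProductSpace

noncomputable section

lemma bproj_add {d : ℕ} (x y v w : EuclideanSpace ℝ (Fin d)) :
    bproj x y (v + w) = bproj x y v + bproj x y w := by
  simp only [bproj, inner_add_right, add_smul]
  abel

lemma bproj_smulv {d : ℕ} (x y : EuclideanSpace ℝ (Fin d)) (c : ℝ)
    (v : EuclideanSpace ℝ (Fin d)) : bproj x y (c • v) = c • bproj x y v := by
  simp only [bproj, inner_smul_right, smul_sub, smul_smul, mul_assoc]

/-- The weighted bearing Laplacian of the framework `(G, p)` with edge weights `w`, as a
linear operator on `(ℝ^d)^V`: `(B u)_i = ∑_{j ∈ N(i)} w i j • P_ij (u_i - u_j)`. -/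
def bearingLapL {d : ℕ} {V : Type*} [Fintype V] (G : SimpleGraph V) [DecidableRel G.Adj]
    (p : V → EuclideanSpace ℝ (Fin d)) (w : V → V → ℝ) :
    (V → EuclideanSpace ℝ (Fin d)) →ₗ[ℝ] (V → EuclideanSpace ℝ (Fin d)) where
  toFun u := fun i => ∑ j ∈ G.neighborFinset i, w i j • bproj (p i) (p j) (u i - u j)
  map_add' u u' := by
    funext i
    dsimp only [Pi.add_apply]
    rw [← Finset.sum_add_distrib]
    refine Finset.sum_congr rfl fun j _ => ?_
    have h : u i + u' i - (u j + u' j) = (u i - u j) + (u' i - u' j) := by abel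
    rw [h, bproj_add, smul_add]
  map_smul' c u := by
    funext i
    dsimp only [RingHom.id_apply, Pi.smul_apply]
    rw [Finset.smul_sum]
    refine Finset.sum_congr rfl fun j _ => ?_
    have h : c • u i - c • u j = c • (u i - u j) := (smul_sub c (u i) (u j)).symm
    rw [h, bproj_smulv, smul_comm]

/-- A framework `(G, p)` is infinitesimally bearing rigid (IBR) if it has at least two
vertices and every infinitesimal motion is an infinitesimal trivial motion. -/
def IsIBR {d : ℕ} {V : Type*} [Fintype V] (G : SimpleGraph V)
    (p : V → EuclideanSpace ℝ (Fin d)) : Prop :=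
  2 ≤ Fintype.card V ∧
    ∀ u : V → EuclideanSpace ℝ (Fin d), IsInfMotion G p u →
      ∃ (α : ℝ) (v : EuclideanSpace ℝ (Fin d)), ∀ i, u i = α • p i + v

lemma bproj_inner_self {d : ℕ} (x y v : EuclideanSpace ℝ (Fin d)) (h : x ≠ y) :
    ⟪v, bproj x y v⟫ = ‖bproj x y v‖ ^ 2 := by
  have hb : ‖(‖y - x‖⁻¹ • (y - x))‖ = 1 := by
    rw [norm_smul, norm_inv, norm_norm]
    exact inv_mul_cancel₀ (norm_ne_zero_iff.mpr (sub_ne_zero.mpr h.symm))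
  unfold bproj
  generalize ‖y - x‖⁻¹ • (y - x) = b at hb
  have hbb : ⟪b, b⟫ = (1 : ℝ) := by rw [real_inner_self_eq_norm_sq, hb]; norm_num
  rw [← real_inner_self_eq_norm_sq]
  simp only [inner_sub_left, inner_sub_right, inner_smul_left, inner_smul_right, hbb,
    real_inner_comm b v]
  simp
  try ring

lemma bproj_swap {d : ℕ} (x y v : EuclideanSpace ℝ (Fin d)) :
    bproj y x v = bproj x y v := by
  unfold bproj
  rw [norm_sub_rev x y, ← neg_sub y x]
  simp only [smul_neg, inner_neg_left, neg_smul, neg_neg]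

lemma bproj_dir {d : ℕ} (x y : EuclideanSpace ℝ (Fin d)) (h : x ≠ y) :
    bproj x y (x - y) = 0 := by
  have hn : ‖y - x‖ ≠ 0 := norm_ne_zero_iff.mpr (sub_ne_zero.mpr h.symm)
  unfold bproj
  rw [← neg_sub y x]
  simp only [inner_neg_right, inner_smul_left, real_inner_self_eq_norm_sq, smul_smul]
  rw [sub_eq_zero, ← neg_one_smul ℝ (y - x)]
  congr 1
  simp
  field_simp

lemma mem_ker_bearingLapL_iff
    {d : ℕ} {V : Type*} [Fintype V]
    (G : SimpleGraph V) [DecidableRel G.Adj]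
    (p : V → EuclideanSpace ℝ (Fin d)) (hp : Function.Injective p)
    (w : V → V → ℝ) (hw : ∀ i j, w i j = w j i)
    (hwpos : ∀ i j, G.Adj i j → 0 < w i j) (u : V → EuclideanSpace ℝ (Fin d)) :
    u ∈ LinearMap.ker (bearingLapL G p w) ↔ IsInfMotion G p u := by
  rw [LinearMap.mem_ker]
  constructor
  · intro h
    let f : V → V → ℝ := fun i j =>
      if G.Adj i j then w i j * ⟪u i, bproj (p i) (p j) (u i - u j)⟫ else 0
    have h1 : ∑ i, ∑ j, f i j = 0 := by
      refine Finset.sum_eq_zero fun i _ => ?_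
      have hi : ∑ j ∈ G.neighborFinset i, w i j • bproj (p i) (p j) (u i - u j) = 0 :=
        congrFun h i
      have h2 := congrArg (fun z => ⟪u i, z⟫) hi
      simp only [inner_sum, inner_smul_right, inner_zero_right] at h2
      rw [← h2, SimpleGraph.neighborFinset_eq_filter, Finset.sum_filter]
    have h2 : ∑ i, ∑ j, f j i = 0 := by rw [Finset.sum_comm]; exact h1
    have h3 : ∑ i, ∑ j, (f i j + f j i) = 0 := by
      simp only [Finset.sum_add_distrib, h1, h2, add_zero]
    have h4 : ∀ i j, f i j + f j i =
        if G.Adj i j then w i j * ‖bproj (p i) (p j) (u i - u j)‖ ^ 2 else 0 := by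
      intro i j
      by_cases hij : G.Adj i j
      · have hs : bproj (p j) (p i) (u j - u i) = - bproj (p i) (p j) (u i - u j) := by
          rw [bproj_swap, ← neg_sub (u i) (u j), ← neg_one_smul ℝ (u i - u j), bproj_smulv,
            neg_one_smul]
        simp only [f, if_pos hij, if_pos hij.symm]
        rw [hs, ← bproj_inner_self _ _ _ (hp.ne hij.ne), hw j i, inner_neg_right,
          inner_sub_left]
        ring
      · have hji : ¬ G.Adj j i := fun h => hij h.symm
        simp [f, hij, hji]
    have h5 : ∀ i j, 0 ≤ f i j + f j i := by
      intro i j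
      rw [h4]
      split_ifs with hij
      · exact mul_nonneg (hwpos i j hij).le (sq_nonneg _)
      · exact le_rfl
    intro i j hij
    have h6 := (Finset.sum_eq_zero_iff_of_nonneg
      (fun i _ => Finset.sum_nonneg fun j _ => h5 i j)).mp h3 i (Finset.mem_univ i)
    have h7 := (Finset.sum_eq_zero_iff_of_nonneg (fun j _ => h5 i j)).mp h6 j
      (Finset.mem_univ j)
    rw [h4, if_pos hij] at h7
    have h8 := (mul_eq_zero.mp h7).resolve_left (hwpos i j hij).ne'
    exact norm_eq_zero.mp (pow_eq_zero_iff (two_ne_zero)|>.mp h8)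
  · intro h
    funext i
    change ∑ j ∈ G.neighborFinset i, w i j • bproj (p i) (p j) (u i - u j) = 0
    refine Finset.sum_eq_zero fun j hj => ?_
    rw [h i j ((G.mem_neighborFinset i j).mp hj), smul_zero]

def trivMotion {d : ℕ} {V : Type*} (p : V → EuclideanSpace ℝ (Fin d)) :
    (ℝ × EuclideanSpace ℝ (Fin d)) →ₗ[ℝ] (V → EuclideanSpace ℝ (Fin d)) where
  toFun x := fun i => x.1 • p i + x.2
  map_add' x y := by
    funext i
    simp only [Prod.fst_add, Prod.snd_add, Pi.add_apply, add_smul]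
    abel
  map_smul' c x := by
    funext i
    simp [smul_smul]

lemma trivMotion_injective {d : ℕ} {V : Type*} [Fintype V]
    (p : V → EuclideanSpace ℝ (Fin d)) (hp : Function.Injective p)
    (hcard : 2 ≤ Fintype.card V) : Function.Injective (trivMotion p) := by
  rw [← LinearMap.ker_eq_bot, LinearMap.ker_eq_bot']
  rintro ⟨α, v⟩ h
  obtain ⟨i, j, hij⟩ := Fintype.exists_pair_of_one_lt_card (show 1 < Fintype.card V by omega)
  have hi : α • p i + v = 0 := congrFun h i
  have hj : α • p j + v = 0 := congrFun h j
  have h1 : α • (p i - p j) = 0 := by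
    rw [smul_sub, sub_eq_zero]
    exact add_right_cancel (hi.trans hj.symm)
  have h2 : α = 0 :=
    (smul_eq_zero.mp h1).resolve_right (sub_ne_zero.mpr (hp.ne hij))
  subst h2
  simp at hi
  simp [hi]

/-- A framework `(G, p)` with `|V| = n ≥ 2` and positive symmetric edge
weights is infinitesimally bearing rigid if and only if the kernel of its weighted bearing
Laplacian `B` has dimension at most `d + 1`. -/
theorem IBR_iff_finrank_ker_bearingLap_le
    {d : ℕ} {V : Type*} [Fintype V] [DecidableEq V]
    (G : SimpleGraph V) [DecidableRel G.Adj]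
    (p : V → EuclideanSpace ℝ (Fin d)) (hp : Function.Injective p)
    (hcard : 2 ≤ Fintype.card V)
    (w : V → V → ℝ) (hw : ∀ i j, w i j = w j i)
    (hwpos : ∀ i j, G.Adj i j → 0 < w i j) :
    IsIBR G p ↔ Module.finrank ℝ (LinearMap.ker (bearingLapL G p w)) ≤ d + 1 := by
  have hT : Module.finrank ℝ (LinearMap.range (trivMotion p)) = d + 1 := by
    rw [LinearMap.finrank_range_of_inj (trivMotion_injective p hp hcard)]
    simp [add_comm]
  have hle : LinearMap.range (trivMotion p) ≤ LinearMap.ker (bearingLapL G p w) := by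
    rintro _ ⟨⟨α, v⟩, rfl⟩
    rw [mem_ker_bearingLapL_iff G p hp w hw hwpos]
    intro i j hij
    have h : trivMotion p (α, v) i - trivMotion p (α, v) j = α • (p i - p j) := by
      change (α • p i + v) - (α • p j + v) = _
      rw [smul_sub]
      abel
    rw [h, bproj_smulv, bproj_dir _ _ (hp.ne hij.ne), smul_zero]
  constructor
  · rintro ⟨-, h⟩
    rw [← hT]
    refine Submodule.finrank_mono fun u hu => ?_
    obtain ⟨α, v, huv⟩ := h u ((mem_ker_bearingLapL_iff G p hp w hw hwpos u).mp hu)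
    exact ⟨(α, v), funext fun i => (huv i).symm⟩
  · intro h
    refine ⟨hcard, fun u hu => ?_⟩
    have heq := Submodule.eq_of_le_of_finrank_le hle (by rw [hT]; exact h)
    have hu' := (mem_ker_bearingLapL_iff G p hp w hw hwpos u).mpr hu
    rw [← heq] at hu'
    obtain ⟨⟨α, v⟩, rfl⟩ := hu'
    exact ⟨α, v, fun i => rfl⟩


end
end
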